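/- Let ℓ be a prime, m ≥ 1, and let H be a subgroup of (ℚ/ℤ)⁴ isomorphic as an abelian group to (ZMod ℓ^m)². Let N = N₀·ℓ^k with k ≥ 0 and gcd(N₀, ℓ) = 1, N₀ ≥ 1. Then the subgroup {x ∈ (ℚ/ℤ)⁴ : N · x ∈ H} is isomorphic as an abelian group to (ZMod N₀)⁴ × (ZMod ℓ^k)² × (ZMod ℓ^{k+m})². -/

import Mathlib

open Module

/-- A subgroup of `ℤ^ι` is cut out by divisibility conditions on the coordinates with respect to
a suitable basis. -/
theorem Submodule.exists_basis_mem_iff_forall_dvd_repr {ι : Type*} [Finite ι]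
    (L : Submodule ℤ (ι → ℤ)) :
    ∃ (b : Basis ι ℤ (ι → ℤ)) (a : ι → ℤ), ∀ v, v ∈ L ↔ ∀ i, a i ∣ b.repr v i := by
  classical
  cases nonempty_fintype ι
  obtain ⟨n, s⟩ := L.smithNormalForm (Pi.basisFun ℤ ι)
  refine ⟨s.bM, Function.extend s.f s.a 0, fun v ↦ ⟨fun hv i ↦ ?_, fun hv ↦ ?_⟩⟩
  · by_cases hi : i ∈ Set.range s.f
    · obtain ⟨j, rfl⟩ := hi
      have := s.repr_apply_embedding_eq_repr_smul ⟨v, hv⟩ (i := j)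
      rw [map_smul, Finsupp.smul_apply, smul_eq_mul] at this
      rw [s.f.injective.extend_apply]
      exact ⟨_, this⟩
    · rw [s.repr_eq_zero_of_notMem_range ⟨v, hv⟩ hi]
      exact dvd_zero _
  · rw [← s.bM.sum_repr v]
    refine L.sum_mem fun i _ ↦ ?_
    by_cases hi : i ∈ Set.range s.f
    · obtain ⟨j, rfl⟩ := hi
      obtain ⟨c, hc⟩ := hv (s.f j)
      rw [s.f.injective.extend_apply] at hc
      rw [hc, mul_comm, mul_smul, ← s.snf]
      exact L.smul_mem _ (s.bN j).2
    · have := hv i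
      rw [Function.extend_apply' _ _ _ hi, Pi.zero_apply, zero_dvd_iff] at this
      simp [this]

open Matrix.Module in
/-- A basis of `ℤ^ι` induces a change of coordinates on `A^ι` for every abelian group `A`. -/
theorem Module.Basis.exists_addEquiv_pi_smul {ι : Type*} [Finite ι] (b : Basis ι ℤ (ι → ℤ))
    (A : Type*) [AddCommGroup A] :
    ∃ e : (ι → A) ≃+ (ι → A), ∀ (v : ι → ℤ) (t : A) (i : ι),
      e (fun j ↦ v j • t) i = b.repr v i • t := by
  classical
  cases nonempty_fintype ι
  let c := Pi.basisFun ℤ ι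
  refine ⟨{ toFun := fun x ↦ b.toMatrix c • x
            invFun := fun x ↦ c.toMatrix b • x
            left_inv := fun x ↦ ?_
            right_inv := fun x ↦ ?_
            map_add' := smul_add _ }, fun v t i ↦ ?_⟩
  · simp only [smul_smul, Basis.toMatrix_mul_toMatrix_flip, one_smul]
  · simp only [smul_smul, Basis.toMatrix_mul_toMatrix_flip, one_smul]
  · have h := congrFun (Basis.toMatrix_mulVec_repr c b v) i
    rw [← h]
    simp [Matrix.mulVec, dotProduct, Finset.sum_smul, mul_smul, c]

theorem AddCircle.mem_zmultiples_one_div_iff {n : ℕ} (hn : 0 < n) (x : AddCircle (1 : ℚ)) :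
    x ∈ AddSubgroup.zmultiples (((1 / n : ℚ)) : AddCircle (1 : ℚ)) ↔ n • x = 0 := by
  constructor
  · rintro ⟨z, rfl⟩
    have h : n • (((1 / n : ℚ)) : AddCircle (1 : ℚ)) = 0 := by
      rw [← addOrderOf_dvd_iff_nsmul_eq_zero, AddCircle.addOrderOf_period_div hn]
    simp only [smul_comm n z, h, smul_zero]
  · intro h
    have : Fact ((0 : ℚ) < 1) := ⟨one_pos⟩
    obtain ⟨m, -, rfl⟩ := (AddCircle.nsmul_eq_zero_iff hn).1 h
    refine ⟨m, ?_⟩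
    simp only [natCast_zsmul, ← AddCircle.coe_nsmul, nsmul_eq_mul, mul_one_div, mul_one]

theorem AddCircle.nonempty_ker_nsmul_addEquiv_zmod {n : ℕ} (hn : 0 < n) :
    Nonempty ((nsmulAddMonoidHom n : AddCircle (1 : ℚ) →+ _).ker ≃+ ZMod n) := by
  have h : (nsmulAddMonoidHom n : AddCircle (1 : ℚ) →+ _).ker =
      AddSubgroup.zmultiples (((1 / n : ℚ)) : AddCircle (1 : ℚ)) := by
    ext x
    rw [AddCircle.mem_zmultiples_one_div_iff hn]
    rfl
  rw [h]
  refine ⟨(zmodAddEquivOfGenerator (g := ⟨_, AddSubgroup.mem_zmultiples _⟩) ?_ ?_).symm⟩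
  · rintro ⟨_, z, rfl⟩
    exact ⟨z, rfl⟩
  · rw [Nat.card_zmultiples, AddCircle.addOrderOf_period_div hn]

/-- Up to an automorphism of `(ℚ/ℤ)^ι`, a subgroup of bounded exponent is a product of torsion
subgroups of the factors. -/
theorem AddCircle.exists_addEquiv_mem_iff_forall_nsmul_eq_zero {ι : Type*} [Finite ι]
    (H : AddSubgroup (ι → AddCircle (1 : ℚ))) {M : ℕ} (hM : 0 < M) (hH : ∀ x ∈ H, M • x = 0) :
    ∃ (e : (ι → AddCircle (1 : ℚ)) ≃+ (ι → AddCircle (1 : ℚ))) (d : ι → ℕ),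
      (∀ i, d i ∣ M) ∧ ∀ x, x ∈ H ↔ ∀ i, d i • e x i = 0 := by
  set t : AddCircle (1 : ℚ) := ((1 / M : ℚ) : AddCircle (1 : ℚ))
  have ht_order : addOrderOf t = M := AddCircle.addOrderOf_period_div hM
  let f : (ι → ℤ) →+ (ι → AddCircle (1 : ℚ)) := (zmultiplesHom _ t).compLeft ι
  have f_apply (v : ι → ℤ) : f v = fun i ↦ v i • t := rfl
  obtain ⟨b, a, hb⟩ := (AddSubgroup.toIntSubmodule (H.comap f)).exists_basis_mem_iff_forall_dvd_repr
  have hmem (v : ι → ℤ) : f v ∈ H ↔ ∀ i, a i ∣ b.repr v i := hb v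
  obtain ⟨e, he⟩ := b.exists_addEquiv_pi_smul (AddCircle (1 : ℚ))
  have ha (i : ι) : a i ∣ M := by
    have h : f ((M : ℤ) • b i) ∈ H := by
      convert H.zero_mem
      ext j
      rw [f_apply, Pi.zero_apply, ← addOrderOf_dvd_iff_zsmul_eq_zero, ht_order]
      exact dvd_mul_right _ _
    have := (hmem _).1 h i
    rwa [map_smul, Finsupp.smul_apply, Basis.repr_self, Finsupp.single_eq_same, smul_eq_mul,
      mul_one] at this
  have hd (i : ι) : M / (a i).natAbs * (a i).natAbs = M :=
    Nat.div_mul_cancel (Int.natAbs_dvd_natAbs.2 (ha i))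
  have hdvd (i : ι) : M / (a i).natAbs ∣ M := ⟨_, (hd i).symm⟩
  refine ⟨e, fun i ↦ M / (a i).natAbs, hdvd, fun x ↦ ?_⟩
  by_cases hx : M • x = 0
  · have hx' (i : ι) : ∃ z : ℤ, z • t = x i :=
      (AddCircle.mem_zmultiples_one_div_iff hM (x i)).2 (congrFun hx i)
    choose v hv using hx'
    obtain rfl : f v = x := funext hv
    rw [hmem]
    refine forall_congr' fun i ↦ ?_
    have hpos : ((M / (a i).natAbs : ℕ) : ℤ) ≠ 0 := by
      intro h0
      have := hd i
      rw [Int.natCast_eq_zero.1 h0] at this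
      omega
    rw [f_apply, he, ← natCast_zsmul, smul_smul, ← addOrderOf_dvd_iff_zsmul_eq_zero, ht_order]
    have hd' : (M : ℤ) = (M / (a i).natAbs : ℕ) * (a i).natAbs := by
      rw [← Nat.cast_mul, hd]
    conv_rhs => lhs; rw [hd']
    rw [mul_dvd_mul_iff_left hpos, Int.natAbs_dvd]
  · refine iff_of_false (fun h ↦ hx (hH x h)) fun h ↦ hx ?_
    apply e.injective
    ext i
    obtain ⟨c, hc⟩ := hdvd i
    rw [map_nsmul, map_zero, Pi.smul_apply, hc, mul_comm, mul_smul, h i, smul_zero, Pi.zero_apply]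

theorem AddCircle.nonempty_addEquiv_pi_zmod {ι : Type*}
    {P : AddSubgroup (ι → AddCircle (1 : ℚ))} {d : ι → ℕ} (hd : ∀ i, 0 < d i)
    (e : (ι → AddCircle (1 : ℚ)) ≃+ (ι → AddCircle (1 : ℚ)))
    (he : ∀ x, x ∈ P ↔ ∀ i, d i • e x i = 0) :
    Nonempty (P ≃+ (∀ i, ZMod (d i))) := by
  let g : P ≃+ (∀ i, (nsmulAddMonoidHom (d i) : AddCircle (1 : ℚ) →+ _).ker) :=
    { toFun := fun x i ↦ ⟨e x i, (he x).1 x.2 i⟩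
      invFun := fun y ↦ ⟨e.symm fun i ↦ y i, (he _).2 fun i ↦ by
        rw [e.apply_symm_apply]
        exact (y i).2⟩
      left_inv := fun x ↦ by simp
      right_inv := fun y ↦ by simp
      map_add' := fun x y ↦ by
        ext i
        simp }
  exact ⟨g.trans (AddEquiv.piCongrRight fun i ↦ (nonempty_ker_nsmul_addEquiv_zmod (hd i)).some)⟩

theorem ZMod.card_nsmul_eq_zero (n d : ℕ) [NeZero d] :
    Nat.card {x : ZMod d // n • x = 0} = d.gcd n := by
  have := IsAddCyclic.card_nsmulAddMonoidHom_ker (G := ZMod d) n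
  rwa [Nat.card_zmod] at this

theorem ZMod.card_pi_nsmul_eq_zero {ι : Type*} [Fintype ι] (n : ℕ) (d : ι → ℕ)
    [∀ i, NeZero (d i)] :
    Nat.card {x : ∀ i, ZMod (d i) // n • x = 0} = ∏ i, (d i).gcd n := by
  have e : {x : ∀ i, ZMod (d i) // n • x = 0} ≃ ∀ i, {x : ZMod (d i) // n • x = 0} :=
    (Equiv.subtypeEquivRight fun x ↦ by simp [funext_iff]).trans Equiv.subtypePiEquivPi
  rw [Nat.card_congr e, Nat.card_pi]
  exact Finset.prod_congr rfl fun i _ ↦ ZMod.card_nsmul_eq_zero n (d i)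

theorem ZMod.card_prod_nsmul_eq_zero (n d d' : ℕ) [NeZero d] [NeZero d'] :
    Nat.card {x : ZMod d × ZMod d' // n • x = 0} = d.gcd n * d'.gcd n := by
  have e : {x : ZMod d × ZMod d' // n • x = 0} ≃
      {x : ZMod d // n • x = 0} × {x : ZMod d' // n • x = 0} :=
    (Equiv.subtypeEquivRight fun x ↦ by simp [Prod.ext_iff]).trans Equiv.subtypeProdEquivProd
  rw [Nat.card_congr e, Nat.card_prod, ZMod.card_nsmul_eq_zero, ZMod.card_nsmul_eq_zero]

theorem Nat.gcd_pow_pow (p a b : ℕ) : (p ^ a).gcd (p ^ b) = p ^ min a b := by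
  rcases le_total a b with h | h
  · rw [min_eq_left h, Nat.gcd_eq_left (pow_dvd_pow p h)]
  · rw [min_eq_right h, Nat.gcd_eq_right (pow_dvd_pow p h)]

/-- The exponents of a decomposition of `(ℤ/ℓ^m)²` into four cyclic `ℓ`-groups. -/
theorem ZMod.exists_perm_of_pi_addEquiv_prod {ℓ m : ℕ} (hℓ : ℓ.Prime) (hm : 1 ≤ m)
    (c : Fin 4 → ℕ) (hc : ∀ i, c i ≤ m)
    (E : (∀ i, ZMod (ℓ ^ c i)) ≃+ ZMod (ℓ ^ m) × ZMod (ℓ ^ m)) :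
    ∃ σ : Equiv.Perm (Fin 4), ∀ i, c (σ i) = (![0, 0, m, m] : Fin 4 → ℕ) i := by
  have : NeZero ℓ := ⟨hℓ.ne_zero⟩
  have key (j : ℕ) : ∑ i, min (c i) j = min m j + min m j := by
    have h : Nat.card {x : ∀ i, ZMod (ℓ ^ c i) // ℓ ^ j • x = 0} =
        Nat.card {x : ZMod (ℓ ^ m) × ZMod (ℓ ^ m) // ℓ ^ j • x = 0} :=
      Nat.card_congr (E.toEquiv.subtypeEquiv fun x ↦ by
        rw [AddEquiv.toEquiv_eq_coe, AddEquiv.coe_toEquiv, ← map_nsmul,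
          EmbeddingLike.map_eq_zero_iff])
    rw [ZMod.card_pi_nsmul_eq_zero, ZMod.card_prod_nsmul_eq_zero] at h
    simp only [Nat.gcd_pow_pow] at h
    rw [Finset.prod_pow_eq_pow_sum, ← pow_add] at h
    exact Nat.pow_right_injective hℓ.two_le h
  have h₁ := key 1
  have hₘ := key m
  simp only [Fin.sum_univ_four] at h₁ hₘ
  have hc0 := hc 0
  have hc1 := hc 1
  have hc2 := hc 2
  have hc3 := hc 3
  have h_or : ∀ i, c i = 0 ∨ c i = m := by
    intro i
    fin_cases i <;> simp <;> omega
  have perm : ∀ g : Fin 4 → Bool, (∑ i, (g i).toNat) = 2 →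
      ∃ σ : Equiv.Perm (Fin 4), ∀ i, g (σ i) = (![false, false, true, true] : Fin 4 → Bool) i := by
    decide
  obtain ⟨σ, hσ⟩ := perm (fun i ↦ decide (c i = m)) (by
    rw [Fin.sum_univ_four]
    rcases h_or 0 with h0 | h0 <;> rcases h_or 1 with h1 | h1 <;> rcases h_or 2 with h2 | h2 <;>
      rcases h_or 3 with h3 | h3 <;> simp [h0, h1, h2, h3, (show 0 ≠ m by omega)] <;> omega)
  refine ⟨σ, fun i ↦ ?_⟩
  have hi := hσ i
  have hi' := h_or (σ i)
  fin_cases i <;> simp at hi hi' ⊢ <;> omega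

/-- Sorting the coordinates of a finite product of pairs into two groups. -/
def AddEquiv.piFinFourProd (A : Type*) [AddCommGroup A] (B : Fin 4 → Type*)
    [∀ i, AddCommGroup (B i)] :
    (∀ i, A × B i) ≃+ (Fin 4 → A) × (B 0 × B 1) × (B 2 × B 3) where
  toFun x := (fun i ↦ (x i).1, ((x 0).2, (x 1).2), ((x 2).2, (x 3).2))
  invFun y i := (y.1 i, Fin.cons (α := B) y.2.1.1 (Fin.cons y.2.1.2
    (Fin.cons y.2.2.1 (Fin.cons y.2.2.2 finZeroElim))) i)
  left_inv x := by
    ext i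
    · rfl
    · fin_cases i <;> rfl
  right_inv _ := rfl
  map_add' _ _ := rfl


/-- Let `ℓ` be a prime, `m ≥ 1`, and `H` a subgroup of `(ℚ/ℤ)⁴` isomorphic as an abelian
group to `(ZMod ℓ^m)²`.  Let `N = N₀·ℓ^k` with `k ≥ 0`, `N₀ ≥ 1` and `gcd(N₀, ℓ) = 1`.
Then the subgroup `{x ∈ (ℚ/ℤ)⁴ : N · x ∈ H}` is isomorphic as an abelian group to
`(ZMod N₀)⁴ × (ZMod ℓ^k)² × (ZMod ℓ^{k+m})²`. -/
theorem stmt_10 (ℓ m : ℕ) (hℓ : ℓ.Prime) (hm : 1 ≤ m)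
    (H : AddSubgroup (Fin 4 → AddCircle (1 : ℚ)))
    (hH : Nonempty (H ≃+ (ZMod (ℓ ^ m) × ZMod (ℓ ^ m))))
    (N N₀ k : ℕ) (hN₀ : 1 ≤ N₀) (hcop : Nat.gcd N₀ ℓ = 1) (hN : N = N₀ * ℓ ^ k) :
    Nonempty
      ((AddSubgroup.comap
          (DistribMulAction.toAddMonoidHom (Fin 4 → AddCircle (1 : ℚ)) ((N : ℤ))) H) ≃+
        ((Fin 4 → ZMod N₀) ×
          (ZMod (ℓ ^ k) × ZMod (ℓ ^ k)) ×
          (ZMod (ℓ ^ (k + m)) × ZMod (ℓ ^ (k + m))))) := by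
  obtain ⟨E⟩ := hH
  have hℓm : 0 < ℓ ^ m := pow_pos hℓ.pos m
  have hNpos : 0 < N := hN ▸ Nat.mul_pos hN₀ (pow_pos hℓ.pos k)
  have hexp : ∀ x ∈ H, ℓ ^ m • x = 0 := by
    intro x hx
    have h : ℓ ^ m • (⟨x, hx⟩ : H) = 0 := by
      apply E.injective
      rw [map_nsmul, map_zero]
      ext
      · simpa only [Nat.card_zmod, Prod.fst_zero, Prod.smul_fst] using
          card_nsmul_eq_zero' (x := (E ⟨x, hx⟩).1)
      · simpa only [Nat.card_zmod, Prod.snd_zero, Prod.smul_snd] using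
          card_nsmul_eq_zero' (x := (E ⟨x, hx⟩).2)
    exact congrArg Subtype.val h
  obtain ⟨e, d, hd, he⟩ :=
    AddCircle.exists_addEquiv_mem_iff_forall_nsmul_eq_zero H hℓm hexp
  choose c hc hdc using fun i ↦ (Nat.dvd_prime_pow hℓ).1 (hd i)
  obtain rfl : d = fun i ↦ ℓ ^ c i := funext hdc
  obtain ⟨F⟩ := AddCircle.nonempty_addEquiv_pi_zmod (fun i ↦ pow_pos hℓ.pos (c i)) e he
  obtain ⟨σ, hσ⟩ := ZMod.exists_perm_of_pi_addEquiv_prod hℓ hm c hc (F.symm.trans E)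
  obtain ⟨G⟩ := AddCircle.nonempty_addEquiv_pi_zmod
    (P := AddSubgroup.comap
      (DistribMulAction.toAddMonoidHom (Fin 4 → AddCircle (1 : ℚ)) ((N : ℤ))) H)
    (d := fun i ↦ ℓ ^ c i * N) (fun i ↦ Nat.mul_pos (pow_pos hℓ.pos (c i)) hNpos) e (fun x ↦ by
      rw [AddSubgroup.mem_comap, DistribMulAction.toAddMonoidHom_apply, he]
      simp only [natCast_zsmul, map_nsmul, Pi.smul_apply, smul_smul])
  let B : Fin 4 → ℕ := ![k, k, k + m, k + m]
  have hB (i : Fin 4) : ℓ ^ c (σ i) * N = N₀ * ℓ ^ B i := by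
    rw [hσ, hN]
    fin_cases i <;> simp [B, pow_add] <;> ring
  have crt (i : Fin 4) : ZMod (ℓ ^ c (σ i) * N) ≃+ ZMod N₀ × ZMod (ℓ ^ B i) :=
    ((ZMod.ringEquivCongr (hB i)).trans
      (ZMod.chineseRemainder (Nat.Coprime.pow_right (B i) hcop))).toAddEquiv
  let reorder : (∀ i, ZMod (ℓ ^ c i * N)) ≃+ (∀ i, ZMod (ℓ ^ c (σ i) * N)) :=
    { (Equiv.piCongrLeft (fun i ↦ ZMod (ℓ ^ c i * N)) σ).symm with
      map_add' := fun _ _ ↦ rfl }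
  exact ⟨G.trans (reorder.trans ((AddEquiv.piCongrRight crt).trans
    (AddEquiv.piFinFourProd (ZMod N₀) fun i ↦ ZMod (ℓ ^ B i))))⟩
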